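/- arXiv:2301.06191 — 4 statements merged into one kernel-verified Lean document; each statement's English description precedes it below -/
import Mathlib

section
/- Let u be as in the context (a radial solution of the Sinh–Gordon equation describing an N-vortex), let L > 0 with L² ≤ 4, and define P(r) = 16r²e^{−u(r)/2}(N+2)² − L²((N+2)r·u'(r) − 4N)((N+2)r·u'(r) − 4N − 16). Then P(r) ≥ 0 for all r ∈ (0, ∞). -/
open Set Filter Topology

/-- A function on `(0, ∞)` with positive second derivative at positive values has no positive
values if it tends to `-∞` at `0` and to `0` at `∞`. -/
lemma nonpos_of_second_deriv_pos {u u' u'' : ℝ → ℝ}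
    (hder1 : ∀ r ∈ Ioi (0:ℝ), HasDerivAt u (u' r) r)
    (hder2 : ∀ r ∈ Ioi (0:ℝ), HasDerivAt u' (u'' r) r)
    (hpos : ∀ r ∈ Ioi (0:ℝ), u' r = 0 → 0 < u r → 0 < u'' r)
    (hbot : Tendsto u (𝓝[>] 0) atBot) (htop : Tendsto u atTop (𝓝 0)) :
    ∀ r ∈ Ioi (0:ℝ), u r ≤ 0 := by
  intro s hs
  by_contra! hus
  have hs0 : (0:ℝ) < s := hs
  obtain ⟨a, ⟨ha0, has⟩, hua⟩ : ∃ a ∈ Ioo 0 s, u a < u s :=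
    (Filter.Eventually.and (Ioo_mem_nhdsGT hs0) (hbot.eventually_lt_atBot (u s))).exists
  obtain ⟨b, hsb, hub⟩ : ∃ b, s < b ∧ u b < u s :=
    ((eventually_gt_atTop s).and (htop.eventually_lt_const hus)).exists
  have hc : ContinuousOn u (Icc a b) := fun x hx =>
    (hder1 x (ha0.trans_le hx.1)).continuousAt.continuousWithinAt
  obtain ⟨m, hm, hmax⟩ := isCompact_Icc.exists_isMaxOn ⟨s, has.le, hsb.le⟩ hc
  have hsm : u s ≤ u m := hmax ⟨has.le, hsb.le⟩
  have ham : a < m := lt_of_le_of_ne hm.1 fun h => by subst h; linarith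
  have hmb : m < b := lt_of_le_of_ne hm.2 fun h => by subst h; linarith
  have hm0 : 0 < m := ha0.trans ham
  have hloc : IsLocalMax u m := hmax.isLocalMax (Icc_mem_nhds ham hmb)
  have hm' : u' m = 0 := hloc.hasDerivAt_eq_zero (hder1 m hm0)
  have hm'' : 0 < u'' m := hpos m hm0 hm' (hus.trans_le hsm)
  have hderiv : deriv u =ᶠ[𝓝 m] u' := by
    filter_upwards [Ioi_mem_nhds hm0] with x hx using (hder1 x hx).deriv
  have hmin : IsLocalMin u m := by
    refine isLocalMin_of_deriv_deriv_pos ?_ ?_ (hder1 m hm0).continuousAt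
    · rwa [hderiv.deriv_eq, (hder2 m hm0).deriv]
    · rw [hderiv.eq_of_nhds, hm']
  have hconst : u =ᶠ[𝓝 m] fun _ => u m := by
    filter_upwards [hloc, hmin] with x h1 h2 using le_antisymm h1 h2
  have hzero : u' =ᶠ[𝓝 m] fun _ => 0 := by
    filter_upwards [hderiv, hconst.deriv] with x h1 h2
    rw [← h1, h2, deriv_const]
  have := hzero.deriv_eq
  rw [(hder2 m hm0).deriv, deriv_const] at this
  exact hm''.ne' this

/-- A function with nonnegative derivative on `(0, ∞)` that dominates a function with limit `c`
at `0` is bounded below by `c`. -/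
lemma le_of_deriv_nonneg_of_tendsto {f f' g : ℝ → ℝ} {c : ℝ}
    (hf : ∀ r ∈ Ioi (0:ℝ), HasDerivAt f (f' r) r) (hf' : ∀ r ∈ Ioi (0:ℝ), 0 ≤ f' r)
    (hg : Tendsto g (𝓝[>] 0) (𝓝 c)) (hgf : ∀ r ∈ Ioi (0:ℝ), g r ≤ f r) :
    ∀ r ∈ Ioi (0:ℝ), c ≤ f r := by
  have hmono : MonotoneOn f (Ioi 0) := by
    refine monotoneOn_of_hasDerivWithinAt_nonneg (f' := f') (convex_Ioi 0)
      (fun x hx => (hf x hx).continuousAt.continuousWithinAt) ?_ ?_ <;> rw [interior_Ioi]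
    · exact fun x hx => (hf x hx).hasDerivWithinAt
    · exact hf'
  intro r hr
  refine le_of_tendsto hg ?_
  filter_upwards [Ioo_mem_nhdsGT (show (0:ℝ) < r from hr)] with x hx
  exact (hgf x hx.1).trans (hmono hx.1 hr hx.2.le)

theorem sinhGordon_P_nonneg
    (N : ℕ) (hN : 0 < N) (u u' u'' : ℝ → ℝ)
    (hder1 : ∀ r ∈ Set.Ioi (0:ℝ), HasDerivAt u (u' r) r)
    (hder2 : ∀ r ∈ Set.Ioi (0:ℝ), HasDerivAt u' (u'' r) r)
    (hcont : ContinuousOn u'' (Set.Ioi (0:ℝ)))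
    (hne : ∃ r ∈ Set.Ioi (0:ℝ), u r ≠ 0)
    (hODE : ∀ r ∈ Set.Ioi (0:ℝ),
      u'' r + u' r / r = Real.exp (u r / 2) - Real.exp (-(u r) / 2))
    (hlim0 : Filter.Tendsto (fun r => r * u' r) (nhdsWithin 0 (Set.Ioi 0))
      (nhds (4 * (N:ℝ) / ((N:ℝ) + 2))))
    (hbot : Filter.Tendsto u (nhdsWithin 0 (Set.Ioi 0)) Filter.atBot)
    (htop : Filter.Tendsto u Filter.atTop (nhds 0))
    (L : ℝ) (hL : 0 < L) (hL4 : L ^ 2 ≤ 4) (P : ℝ → ℝ)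
    (hP : ∀ r, P r = 16 * r ^ 2 * Real.exp (-(u r) / 2) * ((N:ℝ) + 2) ^ 2 -
      L ^ 2 * (((N:ℝ) + 2) * r * u' r - 4 * (N:ℝ)) *
        (((N:ℝ) + 2) * r * u' r - 4 * (N:ℝ) - 16)) :
    ∀ r ∈ Set.Ioi (0:ℝ), 0 ≤ P r := by
  have hu : ∀ r ∈ Ioi (0:ℝ), u r ≤ 0 := by
    refine nonpos_of_second_deriv_pos hder1 hder2 (fun r hr h0 hp => ?_) hbot htop
    have h := hODE r hr
    rw [h0, zero_div, add_zero] at h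
    rw [h, sub_pos, Real.exp_lt_exp]
    linarith
  set α : ℝ := 4 * (N:ℝ) / ((N:ℝ) + 2) with hα
  have hM : (0:ℝ) < (N:ℝ) + 2 := by positivity
  have hα4 : α < 4 := by rw [hα, div_lt_iff₀ hM]; linarith
  have hv : ∀ r ∈ Ioi (0:ℝ), HasDerivAt (fun r => r * u' r)
      (r * (Real.exp (u r / 2) - Real.exp (-(u r) / 2))) r := by
    intro r hr
    have hr0 : r ≠ 0 := (show (0:ℝ) < r from hr).ne'
    refine ((hasDerivAt_id' r).mul (hder2 r hr)).congr_deriv ?_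
    rw [← hODE r hr]
    field_simp
    ring
  have hvα : ∀ r ∈ Ioi (0:ℝ), r * u' r ≤ α := by
    intro r hr
    refine neg_le_neg_iff.mp (le_of_deriv_nonneg_of_tendsto (fun r hr => (hv r hr).neg)
      (fun r hr => ?_) hlim0.neg (fun _ _ => le_rfl) r hr)
    have := hu r hr
    have hexp : Real.exp (u r / 2) ≤ Real.exp (-(u r) / 2) := Real.exp_le_exp.mpr (by linarith)
    have hr0 : (0:ℝ) < r := hr
    nlinarith
  have hQ : ∀ r ∈ Ioi (0:ℝ),
      -(α - 4) ^ 2 ≤ 4 * r ^ 2 * Real.exp (-(u r) / 2) - (r * u' r - 4) ^ 2 := by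
    refine le_of_deriv_nonneg_of_tendsto
      (f' := fun r => 2 * (4 - r * u' r) * r * Real.exp (u r / 2))
      (g := fun r => -(r * u' r - 4) ^ 2) (fun r hr => ?_) (fun r hr => ?_)
      ((hlim0.sub_const 4).pow 2).neg (fun r hr => ?_)
    · have h1 := (((hasDerivAt_id' r).pow 2).const_mul 4).mul (((hder1 r hr).neg.div_const 2).exp)
      refine (h1.sub (((hv r hr).sub_const 4).pow 2)).congr_deriv ?_
      simp only [Pi.pow_apply, Pi.neg_apply]
      push_cast
      ring
    · have := hvα r hr
      have hr0 : (0:ℝ) < r := hr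
      have : 0 ≤ 4 - r * u' r := by linarith
      positivity
    · have : 0 ≤ 4 * r ^ 2 * Real.exp (-(u r) / 2) := by positivity
      linarith
  intro r hr
  have hfactor : P r = ((N:ℝ) + 2) ^ 2 * ((4 - L ^ 2) * (4 * r ^ 2 * Real.exp (-(u r) / 2)) +
      L ^ 2 * (4 * r ^ 2 * Real.exp (-(u r) / 2) - (r * u' r - 4) ^ 2 + (α - 4) ^ 2)) := by
    rw [hP, hα]
    field_simp
    ring
  have h1 : 0 ≤ 4 - L ^ 2 := by linarith
  have h2 : 0 ≤ 4 * r ^ 2 * Real.exp (-(u r) / 2) - (r * u' r - 4) ^ 2 + (α - 4) ^ 2 := by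
    linarith [hQ r hr]
  rw [hfactor]
  positivity
end

section
/- Let u be as in the context (a radial solution of the Sinh–Gordon equation describing an N-vortex), and assume additionally that lim_{r→∞} r·u'(r) = 0. Then the improper integral ∫₀^∞ (e^{u(r)/2} − e^{−u(r)/2})·r dr converges and equals −4N/(N+2). (Equivalently, the total Gaussian curvature of the regular N-vortex surface Σ_N satisfies (1/2π)∫_{Σ_N} K vol = −N/2, confirming the vortex number N via the Gauss–Bonnet theorem with conical singularities.) -/
/-- A differentiable function on `(0, ∞)` which tends to `-∞` at `0` and to `0` at `∞` attains its
maximum as soon as it is positive somewhere. -/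
theorem exists_forall_le_of_tendsto_atBot_of_tendsto_zero {u : ℝ → ℝ}
    (hc : ContinuousOn u (Set.Ioi 0))
    (hbot : Filter.Tendsto u (nhdsWithin 0 (Set.Ioi 0)) Filter.atBot)
    (htop : Filter.Tendsto u Filter.atTop (nhds 0)) {x : ℝ} (hx : 0 < x) (hux : 0 < u x) :
    ∃ m, 0 < m ∧ ∀ r, 0 < r → u r ≤ u m := by
  obtain ⟨a, ha, hau⟩ := (mem_nhdsGT_iff_exists_Ioc_subset.1
    (hbot.eventually_lt_atBot (u x)))
  obtain ⟨b, hbu⟩ := Filter.eventually_atTop.1 (htop.eventually_lt_const hux)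
  have ha' : 0 < a := ha
  have hxa : a < x := by
    by_contra! h
    exact lt_irrefl (u x) (hau ⟨hx, h⟩)
  have hxb : x < b := by
    by_contra! h
    exact lt_irrefl _ (hbu x h)
  obtain ⟨m, hm, hmax⟩ := isCompact_Icc.exists_isMaxOn
    (Set.nonempty_Icc.2 (hxa.trans hxb).le)
    (hc.mono fun r hr => lt_of_lt_of_le ha' hr.1)
  have hxm : u x ≤ u m := hmax ⟨hxa.le, hxb.le⟩
  refine ⟨m, lt_of_lt_of_le ha' hm.1, fun r hr => ?_⟩
  rcases le_total r a with h | h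
  · exact (show u r < u x from hau ⟨hr, h⟩).le.trans hxm
  rcases le_total r b with h' | h'
  · exact hmax ⟨h, h'⟩
  · exact (hbu r h').le.trans hxm

/-- The second derivative is nonpositive at a local maximum. -/
theorem IsLocalMax.second_deriv_nonpos {u u' : ℝ → ℝ} {c m : ℝ} (hm : IsLocalMax u m)
    (hu : ∀ᶠ r in nhds m, HasDerivAt u (u' r) r) (hu' : HasDerivAt u' c m) : c ≤ 0 := by
  by_contra! hc
  have hderiv : deriv u =ᶠ[nhds m] u' := hu.mono fun r hr => hr.deriv
  have h2 : deriv (deriv u) m = c := hderiv.deriv_eq.trans hu'.deriv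
  have hmin : IsLocalMin u m :=
    isLocalMin_of_deriv_deriv_pos (h2 ▸ hc) hm.deriv_eq_zero hu.self_of_nhds.continuousAt
  have hconst : u =ᶠ[nhds m] fun _ => u m := by
    filter_upwards [hm, hmin] with r h1 h3 using le_antisymm h1 h3
  have h0 : deriv (deriv u) m = 0 := by
    rw [hconst.deriv.deriv_eq]
    simp
  linarith

/-- Maximum principle for the radial Sinh–Gordon equation. -/
theorem sinhGordon_nonpos {u u' u'' : ℝ → ℝ}
    (hder1 : ∀ r ∈ Set.Ioi (0:ℝ), HasDerivAt u (u' r) r)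
    (hder2 : ∀ r ∈ Set.Ioi (0:ℝ), HasDerivAt u' (u'' r) r)
    (hODE : ∀ r ∈ Set.Ioi (0:ℝ),
      u'' r + u' r / r = Real.exp (u r / 2) - Real.exp (-(u r) / 2))
    (hbot : Filter.Tendsto u (nhdsWithin 0 (Set.Ioi 0)) Filter.atBot)
    (htop : Filter.Tendsto u Filter.atTop (nhds 0)) {x : ℝ} (hx : 0 < x) : u x ≤ 0 := by
  by_contra! hux
  obtain ⟨m, hm, hmax⟩ := exists_forall_le_of_tendsto_atBot_of_tendsto_zero
    (fun r hr => (hder1 r hr).continuousAt.continuousWithinAt) hbot htop hx hux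
  have hpos : ∀ᶠ r in nhds m, 0 < r := lt_mem_nhds hm
  have hloc : IsLocalMax u m := hpos.mono hmax
  have h1 : u' m = 0 := hloc.hasDerivAt_eq_zero (hder1 m hm)
  have h2 : u'' m ≤ 0 := hloc.second_deriv_nonpos (hpos.mono hder1) (hder2 m hm)
  have h3 := hODE m hm
  have hum := hmax x hx
  have h4 : Real.exp (-(u m) / 2) < Real.exp (u m / 2) := Real.exp_lt_exp.2 (by linarith)
  rw [h1, zero_div] at h3
  linarith


theorem sinhGordon_gaussBonnet
    (N : ℕ) (hN : 0 < N) (u u' u'' : ℝ → ℝ)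
    (hder1 : ∀ r ∈ Set.Ioi (0:ℝ), HasDerivAt u (u' r) r)
    (hder2 : ∀ r ∈ Set.Ioi (0:ℝ), HasDerivAt u' (u'' r) r)
    (hcont : ContinuousOn u'' (Set.Ioi (0:ℝ)))
    (hne : ∃ r ∈ Set.Ioi (0:ℝ), u r ≠ 0)
    (hODE : ∀ r ∈ Set.Ioi (0:ℝ),
      u'' r + u' r / r = Real.exp (u r / 2) - Real.exp (-(u r) / 2))
    (hlim0 : Filter.Tendsto (fun r => r * u' r) (nhdsWithin 0 (Set.Ioi 0))
      (nhds (4 * (N:ℝ) / ((N:ℝ) + 2))))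
    (hbot : Filter.Tendsto u (nhdsWithin 0 (Set.Ioi 0)) Filter.atBot)
    (htop : Filter.Tendsto u Filter.atTop (nhds 0))
    (htopder : Filter.Tendsto (fun r => r * u' r) Filter.atTop (nhds 0)) :
    MeasureTheory.IntegrableOn
      (fun r => (Real.exp (u r / 2) - Real.exp (-(u r) / 2)) * r)
      (Set.Ioi (0:ℝ)) ∧
    ∫ r in Set.Ioi (0:ℝ), (Real.exp (u r / 2) - Real.exp (-(u r) / 2)) * r =
      -(4 * (N:ℝ) / ((N:ℝ) + 2)) := by
  set L := 4 * (N:ℝ) / ((N:ℝ) + 2)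
  let g : ℝ → ℝ := Function.update (fun r => r * u' r) 0 L
  have hg : ∀ r, 0 < r → g r = r * u' r := fun r hr => Function.update_of_ne hr.ne' _ _
  have hg0 : g 0 = L := Function.update_self _ _ _
  have hgc : ContinuousWithinAt g (Set.Ici 0) 0 := by
    rw [continuousWithinAt_update_same, Set.Ici_sdiff_left]
    exact hlim0
  have hgd : ∀ r ∈ Set.Ioi (0:ℝ),
      HasDerivAt g ((Real.exp (u r / 2) - Real.exp (-(u r) / 2)) * r) r := by
    intro r hr
    have hr0 : r ≠ 0 := (show 0 < r from hr).ne'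
    have h := (hasDerivAt_id r).mul (hder2 r hr)
    have he : (1 : ℝ) * u' r + id r * u'' r =
        (Real.exp (u r / 2) - Real.exp (-(u r) / 2)) * r := by
      rw [← hODE r hr, id]
      field_simp
      ring
    rw [he] at h
    exact h.congr_of_eventuallyEq ((lt_mem_nhds hr).mono hg)
  have hneg : ∀ r ∈ Set.Ioi (0:ℝ),
      (Real.exp (u r / 2) - Real.exp (-(u r) / 2)) * r ≤ 0 := by
    intro r hr
    have hu := sinhGordon_nonpos hder1 hder2 hODE hbot htop hr
    have he : Real.exp (u r / 2) ≤ Real.exp (-(u r) / 2) := Real.exp_le_exp.2 (by linarith)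
    exact mul_nonpos_of_nonpos_of_nonneg (sub_nonpos.2 he) (le_of_lt hr)
  have hgtop : Filter.Tendsto g Filter.atTop (nhds 0) :=
    htopder.congr' ((Filter.eventually_gt_atTop 0).mono fun r hr => (hg r hr).symm)
  refine ⟨MeasureTheory.integrableOn_Ioi_deriv_of_nonpos hgc hgd hneg hgtop, ?_⟩
  rw [MeasureTheory.integral_Ioi_of_hasDerivAt_of_nonpos hgc hgd hneg hgtop, hg0, zero_sub]
end

section
/- Let u be as in the context (a radial solution of the Tzitzeica equation describing an N-vortex). Then the surface with metric e^{−2u/3}(dr² + r² dθ²) admits an isometric embedding in ℝ³ as a surface of revolution away from r = 0: there exist continuously differentiable functions ρ, z : (0,∞) → ℝ with ρ(r) = r·e^{−u(r)/3} and ρ'(r)² + z'(r)² = e^{−2u(r)/3} for all r ∈ (0, ∞). -/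
open Set Filter Topology

/-- A function with a positive value on `(0, ∞)` that tends to `-∞` at `0` and to `0` at `∞`
attains its maximum over `(0, ∞)`. -/
theorem exists_isMaxOn_Ioi_of_tendsto_atBot {u : ℝ → ℝ} (hu : ContinuousOn u (Ioi 0))
    (hbot : Tendsto u (𝓝[>] 0) atBot) (htop : Tendsto u atTop (𝓝 0)) {s : ℝ} (hs : 0 < s)
    (hus : 0 < u s) : ∃ t ∈ Ioi (0:ℝ), u s ≤ u t ∧ IsMaxOn u (Ioi 0) t := by
  obtain ⟨a, ha, hua⟩ := mem_nhdsGT_iff_exists_Ioo_subset.1 (hbot.eventually_lt_atBot (u s))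
  obtain ⟨b, hub⟩ := eventually_atTop.1 (htop.eventually_lt_const hus)
  have ha : 0 < a := ha
  have has : a ≤ s := by
    by_contra! h
    exact lt_irrefl (u s) (hua ⟨hs, h⟩)
  have hsb : s ≤ b := by
    by_contra! h
    exact lt_irrefl _ (hub s h.le)
  obtain ⟨t, ht, hmax⟩ := isCompact_Icc.exists_isMaxOn (f := u) ⟨s, has, hsb⟩
    (hu.mono fun x hx => ha.trans_le hx.1)
  refine ⟨t, ha.trans_le ht.1, hmax ⟨has, hsb⟩, fun x hx => ?_⟩
  have hst : u s ≤ u t := hmax ⟨has, hsb⟩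
  have hx : 0 < x := hx
  show u x ≤ u t
  rcases lt_or_ge x a with hxa | hxa
  · exact (lt_of_lt_of_le (hua ⟨hx, hxa⟩ : u x < u s) hst).le
  rcases lt_or_ge b x with hxb | hxb
  · exact ((hub x hxb.le).trans_le hst).le
  · exact hmax ⟨hxa, hxb⟩

/-- At an interior local maximum the second derivative is nonpositive. -/
theorem IsLocalMax.second_deriv_nonpos_s14 {u u' : ℝ → ℝ} {t c : ℝ} (hmax : IsLocalMax u t)
    (h1 : ∀ᶠ x in 𝓝 t, HasDerivAt u (u' x) x) (h2 : HasDerivAt u' c t) : c ≤ 0 := by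
  by_contra! hc
  have hd : deriv u =ᶠ[𝓝 t] u' := h1.mono fun x hx => hx.deriv
  have hdd : deriv (deriv u) t = c := by rw [hd.deriv_eq, h2.deriv]
  have hmin : IsLocalMin u t := isLocalMin_of_deriv_deriv_pos (by rwa [hdd])
    hmax.deriv_eq_zero h1.self_of_nhds.continuousAt
  have hconst : u =ᶠ[𝓝 t] fun _ => u t := by
    filter_upwards [hmax, hmin] with x hx hx' using le_antisymm hx hx'
  have : deriv (deriv u) t = 0 := by simp [hconst.deriv.deriv_eq]
  linarith

/-- The interval integral of a function continuous on `(0, ∞)` is a primitive of it there. -/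
theorem hasDerivAt_integral_of_continuousOn_Ioi {f : ℝ → ℝ} (hf : ContinuousOn f (Ioi 0))
    {a r : ℝ} (ha : 0 < a) (hr : 0 < r) : HasDerivAt (fun x => ∫ t in a..x, f t) (f r) r := by
  refine intervalIntegral.integral_hasDerivAt_right (ContinuousOn.intervalIntegrable
    (hf.mono fun x hx => ?_)) (hf.stronglyMeasurableAtFilter isOpen_Ioi r hr)
    (hf.continuousAt (Ioi_mem_nhds hr))
  exact (lt_min ha hr).trans_le hx.1

/-- A solution of the radial Tzitzeica equation tending to `-∞` at `0` and to `0` at `∞` is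
nonpositive. -/
theorem tzitzeica_nonpos {u u' u'' : ℝ → ℝ}
    (hder1 : ∀ r ∈ Ioi (0:ℝ), HasDerivAt u (u' r) r)
    (hder2 : ∀ r ∈ Ioi (0:ℝ), HasDerivAt u' (u'' r) r)
    (hODE : ∀ r ∈ Ioi (0:ℝ),
      u'' r + u' r / r = Real.exp (u r / 3) - Real.exp (-(2 * u r) / 3))
    (hbot : Tendsto u (𝓝[>] 0) atBot) (htop : Tendsto u atTop (𝓝 0)) {r : ℝ} (hr : 0 < r) :
    u r ≤ 0 := by
  by_contra! hpos
  obtain ⟨t, ht, hst, hmax⟩ := exists_isMaxOn_Ioi_of_tendsto_atBot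
    (fun x hx => (hder1 x hx).continuousAt.continuousWithinAt) hbot htop hr hpos
  have hloc : IsLocalMax u t := hmax.isLocalMax (Ioi_mem_nhds ht)
  have hle : u'' t ≤ 0 := hloc.second_deriv_nonpos_s14
    (mem_of_superset (Ioi_mem_nhds ht) hder1) (hder2 t ht)
  have hode := hODE t ht
  rw [hloc.hasDerivAt_eq_zero (hder1 t ht), zero_div, add_zero] at hode
  have : Real.exp (-(2 * u t) / 3) < Real.exp (u t / 3) := Real.exp_lt_exp.2 (by linarith)
  linarith

/-- For such a solution `r * u' r` is nonincreasing. -/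
theorem tzitzeica_antitoneOn {u u' u'' : ℝ → ℝ}
    (hder2 : ∀ r ∈ Ioi (0:ℝ), HasDerivAt u' (u'' r) r)
    (hODE : ∀ r ∈ Ioi (0:ℝ),
      u'' r + u' r / r = Real.exp (u r / 3) - Real.exp (-(2 * u r) / 3))
    (hu : ∀ r ∈ Ioi (0:ℝ), u r ≤ 0) : AntitoneOn (fun r => r * u' r) (Ioi 0) := by
  have hd : ∀ r ∈ Ioi (0:ℝ), HasDerivAt (fun r => r * u' r) (1 * u' r + r * u'' r) r :=
    fun r hr => (hasDerivAt_id r).mul (hder2 r hr)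
  refine antitoneOn_of_hasDerivWithinAt_nonpos (convex_Ioi 0)
    (f' := fun r => 1 * u' r + r * u'' r)
    (fun r hr => (hd r hr).continuousAt.continuousWithinAt)
    (fun r hr => (hd r (interior_subset hr)).hasDerivWithinAt) fun r hr => ?_
  have hr : 0 < r := interior_subset hr
  have hle : Real.exp (u r / 3) ≤ Real.exp (-(2 * u r) / 3) :=
    Real.exp_le_exp.2 (by linarith [hu r hr])
  have heq : 1 * u' r + r * u'' r = r * (u'' r + u' r / r) := by field_simp; ring
  rw [heq, hODE r hr]
  exact mul_nonpos_of_nonneg_of_nonpos hr.le (by linarith)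

/-- A nonpositive function on `(0, ∞)` tending to `0` at `∞`, with `r * u' r` nonincreasing,
has nonnegative derivative. -/
theorem deriv_nonneg_of_antitoneOn_mul {u u' : ℝ → ℝ}
    (hder : ∀ r ∈ Ioi (0:ℝ), HasDerivAt u (u' r) r) (hu : ∀ r ∈ Ioi (0:ℝ), u r ≤ 0)
    (hanti : AntitoneOn (fun r => r * u' r) (Ioi 0)) (htop : Tendsto u atTop (𝓝 0))
    {r : ℝ} (hr : 0 < r) : 0 ≤ u' r := by
  by_contra! hneg
  have hlt : ∀ x, r ≤ x → u' x < 0 := fun x hx => by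
    have hx0 : 0 < x := hr.trans_le hx
    have h : x * u' x ≤ r * u' r := hanti hr hx0 hx
    have : r * u' r < 0 := mul_neg_of_pos_of_neg hr hneg
    exact neg_of_mul_neg_right (h.trans_lt this) hx0.le
  have hd : ∀ x ∈ Ici r, HasDerivAt u (u' x) x := fun x hx => hder x (hr.trans_le hx)
  have hstrict : StrictAntiOn u (Ici r) :=
    strictAntiOn_of_hasDerivWithinAt_neg (convex_Ici r) (f' := u')
      (fun x hx => (hd x hx).continuousAt.continuousWithinAt)
      (fun x hx => (hd x (interior_subset hx)).hasDerivWithinAt)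
      fun x hx => hlt x (interior_subset hx)
  have hr1 : r + 1 ∈ Ici r := by simp
  have h1 : u (r + 1) < u r := hstrict self_mem_Ici hr1 (by linarith)
  have h0 : 0 ≤ u (r + 1) := le_of_tendsto htop <| by
    filter_upwards [eventually_ge_atTop (r + 1)] with x hx
    exact hstrict.antitoneOn hr1 (mem_Ici.2 (by linarith)) hx
  linarith [hu r hr]

theorem tzitzeica_euclidean_embedding
    (N : ℕ) (hN : 0 < N) (u u' u'' : ℝ → ℝ)
    (hder1 : ∀ r ∈ Set.Ioi (0:ℝ), HasDerivAt u (u' r) r)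
    (hder2 : ∀ r ∈ Set.Ioi (0:ℝ), HasDerivAt u' (u'' r) r)
    (hcont : ContinuousOn u'' (Set.Ioi (0:ℝ)))
    (hne : ∃ r ∈ Set.Ioi (0:ℝ), u r ≠ 0)
    (hODE : ∀ r ∈ Set.Ioi (0:ℝ),
      u'' r + u' r / r = Real.exp (u r / 3) - Real.exp (-(2 * u r) / 3))
    (hlim0 : Filter.Tendsto (fun r => r * u' r) (nhdsWithin 0 (Set.Ioi 0))
      (nhds (6 * (N:ℝ) / (2 * (N:ℝ) + 3))))
    (hbot : Filter.Tendsto u (nhdsWithin 0 (Set.Ioi 0)) Filter.atBot)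
    (htop : Filter.Tendsto u Filter.atTop (nhds 0)) :
    ∃ ρ z ρ' z' : ℝ → ℝ,
      (∀ r ∈ Set.Ioi (0:ℝ), HasDerivAt ρ (ρ' r) r) ∧
      (∀ r ∈ Set.Ioi (0:ℝ), HasDerivAt z (z' r) r) ∧
      ContinuousOn ρ' (Set.Ioi (0:ℝ)) ∧ ContinuousOn z' (Set.Ioi (0:ℝ)) ∧
      (∀ r ∈ Set.Ioi (0:ℝ), ρ r = r * Real.exp (-(u r) / 3)) ∧
      (∀ r ∈ Set.Ioi (0:ℝ), ρ' r ^ 2 + z' r ^ 2 = Real.exp (-(2 * u r) / 3)) := by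
  have hu : ∀ r ∈ Ioi (0:ℝ), u r ≤ 0 := fun r hr =>
    tzitzeica_nonpos hder1 hder2 hODE hbot htop hr
  have hanti := tzitzeica_antitoneOn hder2 hODE hu
  have hlow : ∀ r ∈ Ioi (0:ℝ), 0 ≤ r * u' r := fun r hr =>
    mul_nonneg (le_of_lt hr) (deriv_nonneg_of_antitoneOn_mul hder1 hu hanti htop hr)
  have hupp : ∀ r ∈ Ioi (0:ℝ), r * u' r ≤ 6 := fun r hr => by
    have h : r * u' r ≤ 6 * (N:ℝ) / (2 * (N:ℝ) + 3) := ge_of_tendsto hlim0 <| by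
      filter_upwards [Ioo_mem_nhdsGT hr] with x hx
      exact hanti hx.1 hr hx.2.le
    refine h.trans ?_
    rw [div_le_iff₀ (by positivity)]
    linarith [(N.cast_nonneg : (0:ℝ) ≤ N)]
  have hcu : ContinuousOn u (Ioi 0) := fun r hr => (hder1 r hr).continuousAt.continuousWithinAt
  have hcu' : ContinuousOn u' (Ioi 0) := fun r hr => (hder2 r hr).continuousAt.continuousWithinAt
  let ρ' : ℝ → ℝ := fun r => Real.exp (-(u r) / 3) * (1 - r * u' r / 3)
  let z' : ℝ → ℝ := fun r => √(Real.exp (-(2 * u r) / 3) - ρ' r ^ 2)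
  have hcρ : ContinuousOn ρ' (Ioi 0) := by fun_prop
  have hcz : ContinuousOn z' (Ioi 0) := by fun_prop
  refine ⟨fun r => r * Real.exp (-(u r) / 3), fun r => ∫ t in (1:ℝ)..r, z' t, ρ', z',
    fun r hr => ?_, fun r hr => hasDerivAt_integral_of_continuousOn_Ioi hcz one_pos hr,
    hcρ, hcz, fun _ _ => rfl, fun r hr => ?_⟩
  · refine ((hasDerivAt_id r).mul ((hder1 r hr).neg.div_const 3).exp).congr_deriv ?_
    simp only [ρ', id, Pi.neg_apply]
    ring
  · have hsq : Real.exp (-(2 * u r) / 3) = Real.exp (-(u r) / 3) ^ 2 := by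
      rw [← Real.exp_nat_mul]
      congr 1
      push_cast
      ring
    have hone : (1 - r * u' r / 3) ^ 2 ≤ 1 := by
      rw [sq_le_one_iff_abs_le_one, abs_le]
      constructor <;> linarith [hlow r hr, hupp r hr]
    have hle : ρ' r ^ 2 ≤ Real.exp (-(2 * u r) / 3) := by
      rw [hsq]
      simp only [ρ', mul_pow]
      exact mul_le_of_le_one_right (sq_nonneg _) hone
    simp only [z']
    rw [Real.sq_sqrt (sub_nonneg.2 hle)]
    ring
end

section
/- Let u be as in the context (a radial solution of the Tzitzeica equation describing an N-vortex), let L > 0 with L² ≤ 3, set M = (2N+3)/3 and define P(r) = r²e^{−2u(r)/3} − L²(1 − 1/M − r·u'(r)/3)(1 + 1/M − r·u'(r)/3). Then P(r) ≥ 0 for all r ∈ (0, ∞). Consequently the regular Tzitzeica N-vortex surface with metric e^{−2u/3}(dr² + M² r² dψ²) admits an isometric embedding as a surface of revolution in hyperbolic 3-space of Ricci scalar −6/L²: there exist continuously differentiable functions z, ρ : (0,∞) → ℝ with z(r) > 0 satisfying L·ρ(r)/z(r) = M·r·e^{−u(r)/3} and L²·(z'(r)² + ρ'(r)²)/z(r)²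 = e^{−2u(r)/3} for all r ∈ (0, ∞). -/
open Real Set Filter Topology

/-- A function on `(0, ∞)` with nonnegative derivative stays above the limit at `0⁺` of any
minorant. -/
lemma le_of_hasDerivAt_nonneg_of_tendsto {f f' g : ℝ → ℝ} {c : ℝ}
    (hf : ∀ r ∈ Ioi (0:ℝ), HasDerivAt f (f' r) r) (hf' : ∀ r ∈ Ioi (0:ℝ), 0 ≤ f' r)
    (hgf : ∀ r ∈ Ioi (0:ℝ), g r ≤ f r) (hg : Tendsto g (𝓝[>] 0) (𝓝 c))
    {r : ℝ} (hr : r ∈ Ioi (0:ℝ)) : c ≤ f r := by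
  have hmono : MonotoneOn f (Ioi 0) := by
    refine monotoneOn_of_hasDerivWithinAt_nonneg (convex_Ioi 0)
      (fun x hx => (hf x hx).continuousAt.continuousWithinAt) (f' := f') ?_ ?_ <;>
      rw [interior_Ioi]
    · exact fun x hx => (hf x hx).hasDerivWithinAt
    · exact hf'
  refine le_of_tendsto hg ?_
  filter_upwards [Ioo_mem_nhdsGT (mem_Ioi.1 hr)] with s hs
  exact (hgf s hs.1).trans (hmono hs.1 hr hs.2.le)

/-- At an interior local maximum the second derivative is nonpositive. -/
lemma IsLocalMax.second_hasDerivAt_nonpos {u u' : ℝ → ℝ} {c r : ℝ}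
    (hmax : IsLocalMax u r) (h1 : ∀ᶠ x in 𝓝 r, HasDerivAt u (u' x) x)
    (h2 : HasDerivAt u' c r) : c ≤ 0 := by
  by_contra! hc
  have hd : deriv u =ᶠ[𝓝 r] u' := h1.mono fun x hx => hx.deriv
  have hmin : IsLocalMin u r := by
    refine isLocalMin_of_deriv_deriv_pos ?_ hmax.deriv_eq_zero h1.self_of_nhds.continuousAt
    rwa [hd.deriv_eq, h2.deriv]
  have hconst : u =ᶠ[𝓝 r] fun _ => u r := by
    filter_upwards [hmax, hmin] with x hx hx' using le_antisymm hx hx'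
  have hzero : u' =ᶠ[𝓝 r] fun _ => 0 := by
    filter_upwards [hd, hconst.eventuallyEq_nhds] with x hx hx'
    rw [← hx, hx'.deriv_eq, deriv_const]
  have := h2.deriv
  rw [hzero.deriv_eq, deriv_const] at this
  linarith

/-- A function on `(0, ∞)` that is positive somewhere, tends to `-∞` at `0⁺` and to `0` at
infinity has a positive local maximum. -/
lemma exists_isLocalMax_pos {u : ℝ → ℝ} (hu : ContinuousOn u (Ioi 0))
    (hbot : Tendsto u (𝓝[>] 0) atBot) (htop : Tendsto u atTop (𝓝 0))
    {r : ℝ} (hr : 0 < r) (hpos : 0 < u r) :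
    ∃ x, 0 < x ∧ 0 < u x ∧ IsLocalMax u x := by
  obtain ⟨a, ha0, ha⟩ := (mem_nhdsGT_iff_exists_Ioo_subset).1
    (hbot.eventually (eventually_lt_atBot 0))
  obtain ⟨b, hb⟩ := eventually_atTop.1 (htop.eventually (gt_mem_nhds hpos))
  have ha0' : 0 < a := ha0
  set α := min a r / 2
  have hα : 0 < α := by positivity
  have hαa : α < a := by
    have := min_le_left a r
    have : 0 < min a r := lt_min ha0' hr
    simp only [α]; linarith
  have hαr : α < r := by
    have := min_le_right a r
    have : 0 < min a r := lt_min ha0' hr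
    simp only [α]; linarith
  set β := max b r + 1
  have hβb : b < β := by have := le_max_left b r; simp only [β]; linarith
  have hβr : r < β := by have := le_max_right b r; simp only [β]; linarith
  obtain ⟨x, hx, hmax⟩ := isCompact_Icc.exists_isMaxOn ⟨r, hαr.le, hβr.le⟩
    (hu.mono fun y hy => hα.trans_le hy.1 : ContinuousOn u (Icc α β))
  have hrx : u r ≤ u x := hmax ⟨hαr.le, hβr.le⟩
  have hxα : α < x := by
    refine lt_of_le_of_ne hx.1 fun h => ?_
    have : u x < 0 := h ▸ ha ⟨hα, hαa⟩
    linarith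
  have hxβ : x < β := by
    refine lt_of_le_of_ne hx.2 fun h => ?_
    have : u x < u r := h ▸ hb β hβb.le
    linarith
  exact ⟨x, hα.trans hxα, hpos.trans_le hrx, hmax.isLocalMax (Icc_mem_nhds hxα hxβ)⟩

/-- A continuous function on `(0, ∞)` has a primitive there. -/
lemma exists_hasDerivAt_of_continuousOn_Ioi {f : ℝ → ℝ} (hf : ContinuousOn f (Ioi 0)) :
    ∃ g : ℝ → ℝ, ∀ r ∈ Ioi (0:ℝ), HasDerivAt g (f r) r := by
  refine ⟨fun r => ∫ t in (1:ℝ)..r, f t, fun r hr => ?_⟩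
  refine intervalIntegral.integral_hasDerivAt_right ?_ ?_ (hf.continuousAt (Ioi_mem_nhds hr))
  · refine (hf.mono fun x hx => ?_).intervalIntegrable
    exact (lt_min one_pos (mem_Ioi.1 hr)).trans_le hx.1
  · exact hf.stronglyMeasurableAtFilter isOpen_Ioi r hr

/-- A metric `ω² (dr² + …)` whose circle of parameter `r` has radius `L * s r` embeds in hyperbolic
space as a surface of revolution as soon as `L² s'² ≤ (1 + s²) ω²`. -/
lemma exists_hyperbolic_profile {L : ℝ} (hL : 0 < L) {s s' ω : ℝ → ℝ}
    (hs : ∀ r ∈ Ioi (0:ℝ), HasDerivAt s (s' r) r) (hs' : ContinuousOn s' (Ioi 0))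
    (hω : ContinuousOn ω (Ioi 0))
    (hdisc : ∀ r ∈ Ioi (0:ℝ), L ^ 2 * s' r ^ 2 ≤ (1 + s r ^ 2) * ω r ^ 2) :
    ∃ z ρ z' ρ' : ℝ → ℝ,
      (∀ r ∈ Ioi (0:ℝ), HasDerivAt z (z' r) r) ∧
      (∀ r ∈ Ioi (0:ℝ), HasDerivAt ρ (ρ' r) r) ∧
      ContinuousOn z' (Ioi (0:ℝ)) ∧ ContinuousOn ρ' (Ioi (0:ℝ)) ∧
      (∀ r ∈ Ioi (0:ℝ), 0 < z r) ∧
      (∀ r ∈ Ioi (0:ℝ), ρ r / z r = s r) ∧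
      (∀ r ∈ Ioi (0:ℝ), L ^ 2 * (z' r ^ 2 + ρ' r ^ 2) / z r ^ 2 = ω r ^ 2) := by
  have hsc : ContinuousOn s (Ioi 0) := fun r hr => (hs r hr).continuousAt.continuousWithinAt
  set D : ℝ → ℝ := fun r => (1 + s r ^ 2) * ω r ^ 2 / L ^ 2 - s' r ^ 2 with hD
  have hD0 : ∀ r ∈ Ioi (0:ℝ), 0 ≤ D r := fun r hr => by
    simp only [hD]
    rw [sub_nonneg, le_div_iff₀ (by positivity)]
    linarith [hdisc r hr]
  set f : ℝ → ℝ := fun r => (-(s r * s' r) + √(D r)) / (1 + s r ^ 2) with hf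
  have hfc : ContinuousOn f (Ioi 0) := by
    have hDc : ContinuousOn D (Ioi 0) := by simp only [hD]; fun_prop
    exact ((hsc.mul hs').neg.add hDc.sqrt).div (by fun_prop) fun r _ => by positivity
  obtain ⟨g, hg⟩ := exists_hasDerivAt_of_continuousOn_Ioi hfc
  have hgc : ContinuousOn g (Ioi 0) := fun r hr => (hg r hr).continuousAt.continuousWithinAt
  refine ⟨fun r => exp (g r), fun r => s r * exp (g r), fun r => exp (g r) * f r,
    fun r => s' r * exp (g r) + s r * (exp (g r) * f r), fun r hr => (hg r hr).exp,
    fun r hr => (hs r hr).mul (hg r hr).exp, by fun_prop, by fun_prop,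
    fun r _ => exp_pos _, fun r _ => mul_div_cancel_right₀ _ (exp_pos _).ne', fun r hr => ?_⟩
  have hquad : f r ^ 2 + (s' r + s r * f r) ^ 2 = ω r ^ 2 / L ^ 2 := by
    have hpos : 1 + s r ^ 2 ≠ 0 := by positivity
    have hfr : (1 + s r ^ 2) * f r + s r * s' r = √(D r) := by
      simp only [hf]; field_simp; ring
    have hsq : ((1 + s r ^ 2) * f r + s r * s' r) ^ 2
        = (1 + s r ^ 2) * (ω r ^ 2 / L ^ 2) - s' r ^ 2 := by
      rw [hfr, sq_sqrt (hD0 r hr), hD]; ring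
    apply mul_left_cancel₀ hpos
    linear_combination hsq
  have hexp := (exp_pos (g r)).ne'
  have hfac : L ^ 2 * ((exp (g r) * f r) ^ 2 + (s' r * exp (g r) + s r * (exp (g r) * f r)) ^ 2)
      / exp (g r) ^ 2 = L ^ 2 * (f r ^ 2 + (s' r + s r * f r) ^ 2) := by
    field_simp
  simp only [hfac, hquad]
  field_simp


theorem tzitzeica_hyperbolic_embedding
    (N : ℕ) (hN : 0 < N) (u u' u'' : ℝ → ℝ)
    (hder1 : ∀ r ∈ Set.Ioi (0:ℝ), HasDerivAt u (u' r) r)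
    (hder2 : ∀ r ∈ Set.Ioi (0:ℝ), HasDerivAt u' (u'' r) r)
    (hcont : ContinuousOn u'' (Set.Ioi (0:ℝ)))
    (hne : ∃ r ∈ Set.Ioi (0:ℝ), u r ≠ 0)
    (hODE : ∀ r ∈ Set.Ioi (0:ℝ),
      u'' r + u' r / r = Real.exp (u r / 3) - Real.exp (-(2 * u r) / 3))
    (hlim0 : Filter.Tendsto (fun r => r * u' r) (nhdsWithin 0 (Set.Ioi 0))
      (nhds (6 * (N:ℝ) / (2 * (N:ℝ) + 3))))
    (hbot : Filter.Tendsto u (nhdsWithin 0 (Set.Ioi 0)) Filter.atBot)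
    (htop : Filter.Tendsto u Filter.atTop (nhds 0))
    (L : ℝ) (hL : 0 < L) (hL3 : L ^ 2 ≤ 3) (M : ℝ) (hM : M = (2 * (N:ℝ) + 3) / 3)
    (P : ℝ → ℝ)
    (hP : ∀ r, P r = r ^ 2 * Real.exp (-(2 * u r) / 3) -
      L ^ 2 * (1 - 1 / M - r * u' r / 3) * (1 + 1 / M - r * u' r / 3)) :
    (∀ r ∈ Set.Ioi (0:ℝ), 0 ≤ P r) ∧
    ∃ z ρ z' ρ' : ℝ → ℝ,
      (∀ r ∈ Set.Ioi (0:ℝ), HasDerivAt z (z' r) r) ∧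
      (∀ r ∈ Set.Ioi (0:ℝ), HasDerivAt ρ (ρ' r) r) ∧
      ContinuousOn z' (Set.Ioi (0:ℝ)) ∧ ContinuousOn ρ' (Set.Ioi (0:ℝ)) ∧
      (∀ r ∈ Set.Ioi (0:ℝ), 0 < z r) ∧
      (∀ r ∈ Set.Ioi (0:ℝ), L * ρ r / z r = M * r * Real.exp (-(u r) / 3)) ∧
      (∀ r ∈ Set.Ioi (0:ℝ),
        L ^ 2 * (z' r ^ 2 + ρ' r ^ 2) / z r ^ 2 = Real.exp (-(2 * u r) / 3)) := by
  have hM0 : 0 < M := by rw [hM]; positivity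
  have huc : ContinuousOn u (Ioi 0) := fun r hr => (hder1 r hr).continuousAt.continuousWithinAt
  have huc' : ContinuousOn u' (Ioi 0) := fun r hr => (hder2 r hr).continuousAt.continuousWithinAt
  have hu0 : ∀ r ∈ Ioi (0:ℝ), u r ≤ 0 := by
    intro r hr
    by_contra! hpos
    obtain ⟨x, hx, hux, hmax⟩ := exists_isLocalMax_pos huc hbot htop hr hpos
    have h2 := hmax.second_hasDerivAt_nonpos
      (eventually_of_mem (Ioi_mem_nhds hx) hder1) (hder2 x hx)
    have h1 : u' x = 0 := hmax.hasDerivAt_eq_zero (hder1 x hx)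
    have h3 := hODE x hx
    have h4 : exp (-(2 * u x) / 3) < exp (u x / 3) := exp_lt_exp.2 (by linarith)
    rw [h1] at h3
    simp only [zero_div, add_zero] at h3
    linarith
  set a : ℝ → ℝ := fun r => 1 - r * u' r / 3 with ha
  have hader : ∀ r ∈ Ioi (0:ℝ),
      HasDerivAt a (r * (exp (-(2 * u r) / 3) - exp (u r / 3)) / 3) r := by
    intro r hr
    have hr0 : r ≠ 0 := (mem_Ioi.1 hr).ne'
    refine ((((hasDerivAt_id r).mul (hder2 r hr)).div_const 3).const_sub 1).congr_deriv ?_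
    have h := hODE r hr
    have h' : u'' r * r + u' r = r * (exp (u r / 3) - exp (-(2 * u r) / 3)) := by
      rw [← h]; field_simp
    simp only [id]
    linear_combination -h' / 3
  have halim : Tendsto a (𝓝[>] 0) (𝓝 (1 / M)) := by
    convert (hlim0.div_const 3).const_sub 1 using 2
    rw [hM]; field_simp; ring
  have hapos : ∀ r ∈ Ioi (0:ℝ), 0 ≤ a r := by
    intro r hr
    refine (by positivity : 0 ≤ 1 / M).trans
      (le_of_hasDerivAt_nonneg_of_tendsto hader (fun x hx => ?_) (fun _ _ => le_rfl) halim hr)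
    have hexp : exp (u x / 3) ≤ exp (-(2 * u x) / 3) := exp_le_exp.2 (by linarith [hu0 x hx])
    exact div_nonneg (mul_nonneg (le_of_lt hx) (sub_nonneg.2 hexp)) (by norm_num)
  have hPa : ∀ r, P r = r ^ 2 * exp (-(2 * u r) / 3) - L ^ 2 * (a r ^ 2 - (1 / M) ^ 2) := by
    intro r; rw [hP]; simp only [ha]; ring
  have hPder : ∀ r ∈ Ioi (0:ℝ), HasDerivAt P
      (2 * r * a r * ((1 - L ^ 2 / 3) * exp (-(2 * u r) / 3) + L ^ 2 / 3 * exp (u r / 3))) r := by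
    intro r hr
    rw [funext hPa]
    have he := ((((hder1 r hr).const_mul 2).neg).div_const 3).exp
    refine (((hasDerivAt_pow 2 r).mul he).sub
      ((((hader r hr).pow 2).sub_const ((1 / M) ^ 2)).const_mul (L ^ 2))).congr_deriv ?_
    simp only [ha, Nat.cast_ofNat, Pi.neg_apply]
    ring
  have hPnonneg : ∀ r ∈ Ioi (0:ℝ), 0 ≤ P r := by
    intro r hr
    refine le_of_hasDerivAt_nonneg_of_tendsto (g := fun r => -(L ^ 2 * (a r ^ 2 - (1 / M) ^ 2)))
      hPder (fun x hx => ?_) (fun x _ => ?_) ?_ hr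
    · have hx0 : 0 < x := hx
      have := hapos x hx
      have : 0 ≤ 1 - L ^ 2 / 3 := by linarith
      positivity
    · have : 0 ≤ x ^ 2 * exp (-(2 * u x) / 3) := by positivity
      rw [hPa]; linarith
    · convert (((halim.pow 2).sub_const ((1 / M) ^ 2)).const_mul (L ^ 2)).neg using 2
      ring
  refine ⟨hPnonneg, ?_⟩
  have hsq : ∀ r, exp (-(u r) / 3) ^ 2 = exp (-(2 * u r) / 3) := fun r => by
    rw [← exp_nat_mul]; congr 1; push_cast; ring
  obtain ⟨z, ρ, z', ρ', hz, hρ, hzc, hρc, hz0, hratio, hmetric⟩ :=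
    exists_hyperbolic_profile hL (s := fun r => M * r * exp (-(u r) / 3) / L)
      (s' := fun r => M * a r * exp (-(u r) / 3) / L) (ω := fun r => exp (-(u r) / 3))
      (fun r hr => by
        have he := ((hder1 r hr).neg.div_const 3).exp
        refine ((((hasDerivAt_id r).const_mul M).mul he).div_const L).congr_deriv ?_
        simp only [ha, id, Pi.neg_apply]
        ring)
      (by simp only [ha]; fun_prop) (by fun_prop)
      (fun r hr => by
        have hPr := hPnonneg r hr
        rw [hPa, ← hsq] at hPr
        have hid : (1 + (M * r * exp (-(u r) / 3) / L) ^ 2) * exp (-(u r) / 3) ^ 2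
            - L ^ 2 * (M * a r * exp (-(u r) / 3) / L) ^ 2
            = M ^ 2 / L ^ 2 * exp (-(u r) / 3) ^ 2 *
              (r ^ 2 * exp (-(u r) / 3) ^ 2 - L ^ 2 * (a r ^ 2 - (1 / M) ^ 2)) := by
          field_simp
          ring
        rw [← sub_nonneg, hid]
        positivity)
  refine ⟨z, ρ, z', ρ', hz, hρ, hzc, hρc, hz0, fun r hr => ?_, fun r hr => ?_⟩
  · rw [mul_div_assoc, hratio r hr]
    field_simp
  · rw [hmetric r hr, hsq]
end
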